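/- arXiv:1802.03854 — 4 statements merged into one kernel-verified Lean document; each statement's English description precedes it below -/
import Mathlib

section
/- Let α ∈ ℂ \ ℝ and let Λ = (ℤ + ℤα)(−e_1 − e_2) + (ℤ + ℤα)(e_1 − e_2) + (ℤ + ℤα)(e_2 − e_3) ⊆ ℂ³ (a G(2,2,3)-invariant ℤ-lattice of full rank 6; here G(2,2,3) is the Weyl group W(D_3) of 3×3 signed permutation matrices with an even number of sign changes). Then the affine reflection group W = G(2,2,3) ⋉ Λ has the Steinberg property: every point of ℂ³ fixed by some non-identity element of W lies on a reflecting hyperplane of W. -/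
open Matrix Complex

noncomputable section

/-- `ℤ[ζ] = ℤ + ℤζ` as a subset of `ℂ`. -/
def Zlat (ζ : ℂ) : Set ℂ := {z | ∃ a b : ℤ, z = (a : ℂ) + (b : ℂ) * ζ}

/-- Membership in the complex reflection group `G(r,p,n)`: monomial matrices whose
nonzero entries are `r`-th roots of unity and whose product of nonzero entries,
raised to the power `r / p`, equals `1`. -/
def IsGrpn (r p n : ℕ) (M : Matrix (Fin n) (Fin n) ℂ) : Prop :=
  (∀ i, ∃! j, M i j ≠ 0) ∧ (∀ j, ∃! i, M i j ≠ 0) ∧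
  (∀ i j, M i j ≠ 0 → M i j ^ r = 1) ∧
  (∏ i, ∑ j, M i j) ^ (r / p) = 1

/-- The affine transformation `v ↦ M v + t` encoded by the pair `g = (M, t)`. -/
def applyAff {n : ℕ} (g : Matrix (Fin n) (Fin n) ℂ × (Fin n → ℂ)) (v : Fin n → ℂ) :
    Fin n → ℂ :=
  g.1.mulVec v + g.2

/-- An affine hyperplane in `ℂⁿ`: the solution set of a nonzero affine-linear equation. -/
def IsAffineHyperplane {n : ℕ} (H : Set (Fin n → ℂ)) : Prop :=
  ∃ a : Fin n → ℂ, a ≠ 0 ∧ ∃ c : ℂ, H = {v | ∑ i, a i * v i = c}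

/-- A reflecting hyperplane of `W`: an affine hyperplane fixed pointwise by some
non-identity element of `W`. -/
def IsReflectingHyperplane {n : ℕ}
    (W : Matrix (Fin n) (Fin n) ℂ × (Fin n → ℂ) → Prop) (H : Set (Fin n → ℂ)) : Prop :=
  IsAffineHyperplane H ∧
  ∃ g, W g ∧ (∃ v, applyAff g v ≠ v) ∧ ∀ v ∈ H, applyAff g v = v

/-- `W` has the Steinberg property: every point fixed by some non-identity element
of `W` lies on a reflecting hyperplane of `W`. -/
def SteinbergProperty {n : ℕ}
    (W : Matrix (Fin n) (Fin n) ℂ × (Fin n → ℂ) → Prop) : Prop :=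
  ∀ u : Fin n → ℂ,
    (∃ g, W g ∧ (∃ v, applyAff g v ≠ v) ∧ applyAff g u = u) →
    ∃ H, IsReflectingHyperplane W H ∧ u ∈ H

/-- `stdGen n 0 = e₁` and, for `j ≥ 1` (0-indexed), `stdGen n j = e_{j-1} - e_j`. -/
def stdGen (n : ℕ) (j : Fin n) : Fin n → ℂ := fun i =>
  if i = j then (if (j : ℕ) = 0 then 1 else -1)
  else if (i : ℕ) + 1 = (j : ℕ) then 1 else 0

/-- `genB n ξ 0 = ξ e₁ - e₂` and, for `j ≥ 1` (0-indexed), `genB n ξ j = e_{j-1} - e_j`. -/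
def genB (n : ℕ) (ξ : ℂ) (j : Fin n) : Fin n → ℂ :=
  if (j : ℕ) = 0 then
    (fun i => if (i : ℕ) = 0 then ξ else if (i : ℕ) = 1 then -1 else 0)
  else stdGen n j

theorem Zlat.neg_mem {ζ x : ℂ} (hx : x ∈ Zlat ζ) : -x ∈ Zlat ζ := by
  obtain ⟨a, b, rfl⟩ := hx
  exact ⟨-a, -b, by push_cast; ring⟩

theorem Zlat.add_mem {ζ x y : ℂ} (hx : x ∈ Zlat ζ) (hy : y ∈ Zlat ζ) : x + y ∈ Zlat ζ := by
  obtain ⟨a, b, rfl⟩ := hx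
  obtain ⟨c, d, rfl⟩ := hy
  exact ⟨a + c, b + d, by push_cast; ring⟩

theorem Zlat.zero_mem (ζ : ℂ) : 0 ∈ Zlat ζ := ⟨0, 0, by simp⟩

/-- The lattice `D₃ ⊗ ℤ[α]`, spanned by the simple roots of `D₃` over `ℤ[α]`. -/
def latticeD3 (α : ℂ) : Set (Fin 3 → ℂ) :=
  {v | ∃ a b c : ℂ, a ∈ Zlat α ∧ b ∈ Zlat α ∧ c ∈ Zlat α ∧
    v = a • ![-1, -1, 0] + b • ![1, -1, 0] + c • ![0, 1, -1]}

theorem mem_latticeD3_iff {α : ℂ} {t : Fin 3 → ℂ} :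
    t ∈ latticeD3 α ↔ (∀ i, t i ∈ Zlat α) ∧ ∃ s ∈ Zlat α, t 0 + t 1 + t 2 = 2 * s := by
  constructor
  · rintro ⟨a, b, c, ha, hb, hc, rfl⟩
    have ha' := Zlat.neg_mem ha
    refine ⟨fun i => ?_, -a, ha', by simp; ring⟩
    fin_cases i
    · simpa using Zlat.add_mem ha' hb
    · simpa using Zlat.add_mem (Zlat.add_mem ha' (Zlat.neg_mem hb)) hc
    · simpa using Zlat.neg_mem hc
  · rintro ⟨ht, s, hs, hsum⟩
    refine ⟨-s, t 0 + -s, -t 2, Zlat.neg_mem hs, Zlat.add_mem (ht 0) (Zlat.neg_mem hs),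
      Zlat.neg_mem (ht 2), ?_⟩
    ext i
    fin_cases i
    · simp
    · simp
      linear_combination hsum
    · simp

/-- The vector `e_i - ε e_j`, a root of `D₃` when `i ≠ j` and `ε = ±1`. -/
def rootD3 (i j : Fin 3) (ε : ℂ) : Fin 3 → ℂ := Pi.single i 1 - ε • Pi.single j 1

theorem isGrpn_reflection {i j : Fin 3} (hij : i ≠ j) {ε : ℂ} (hε : ε = 1 ∨ ε = -1) :
    IsGrpn 2 2 3 (1 - vecMulVec (rootD3 i j ε) (rootD3 i j ε)) := by
  rcases hε with rfl | rfl <;> fin_cases i <;> fin_cases j <;>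
    first
    | exact absurd rfl hij
    | simp [IsGrpn, ExistsUnique, Fin.forall_fin_succ, Fin.exists_fin_succ, Fin.prod_univ_succ,
        Fin.sum_univ_succ, vecMulVec_apply, rootD3, Matrix.one_apply, Pi.single_apply]

theorem smul_root_mem_latticeD3 {α : ℂ} {i j : Fin 3} (hij : i ≠ j) {ε : ℂ}
    (hε : ε = 1 ∨ ε = -1) {c : ℂ} (hc : c ∈ Zlat α) :
    c • rootD3 i j ε ∈ latticeD3 α := by
  have h0 := Zlat.zero_mem α
  have hn := Zlat.neg_mem hc
  refine mem_latticeD3_iff.2 ⟨fun k => ?_, ?_⟩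
  · rcases hε with rfl | rfl <;> by_cases hi : k = i <;> by_cases hj : k = j <;>
      simp_all [rootD3]
  · rcases hε with rfl | rfl
    · refine ⟨0, h0, ?_⟩
      fin_cases i <;> fin_cases j <;> simp_all [rootD3]
    · refine ⟨c, hc, ?_⟩
      fin_cases i <;> fin_cases j <;> first
        | exact absurd rfl hij
        | (simp [rootD3]; ring)

theorem exists_reflectingHyperplane {α : ℂ} {u : Fin 3 → ℂ} {i j : Fin 3} (hij : i ≠ j) {ε : ℂ}
    (hε : ε = 1 ∨ ε = -1) (hu : u i - ε * u j ∈ Zlat α) :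
    ∃ H, IsReflectingHyperplane (fun g => IsGrpn 2 2 3 g.1 ∧ g.2 ∈ latticeD3 α) H ∧ u ∈ H := by
  have hdot (v : Fin 3 → ℂ) : rootD3 i j ε ⬝ᵥ v = v i - ε * v j := by
    simp [rootD3, sub_dotProduct]
  have happ (c : ℂ) (v : Fin 3 → ℂ) :
      applyAff (1 - vecMulVec (rootD3 i j ε) (rootD3 i j ε), c • rootD3 i j ε) v =
        v + (c - (v i - ε * v j)) • rootD3 i j ε := by
    ext k
    simp [applyAff, sub_mulVec, vecMulVec_mulVec, hdot]
    ring
  have hne : rootD3 i j ε ≠ 0 := fun h => by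
    simpa [rootD3, hij] using congrFun h i
  refine ⟨{v | ∑ k, rootD3 i j ε k * v k = u i - ε * u j},
    ⟨⟨_, hne, _, rfl⟩, (_, _), ⟨isGrpn_reflection hij hε, smul_root_mem_latticeD3 hij hε hu⟩,
      ⟨Pi.single i (u i - ε * u j + 1), ?_⟩, fun v hv => ?_⟩, hdot u⟩
  · rw [happ]
    simpa [hij.symm] using hne
  · have hv' : v i - ε * v j = u i - ε * u j := (hdot v).symm.trans hv
    rw [happ, hv']
    simp

theorem mulVec_apply_of_existsUnique {M : Matrix (Fin 3) (Fin 3) ℂ} {i j : Fin 3}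
    (h : ∃! j, M i j ≠ 0) (hij : M i j ≠ 0) (u : Fin 3 → ℂ) : (M *ᵥ u) i = M i j * u j := by
  rw [mulVec, dotProduct, Finset.sum_eq_single_of_mem j (Finset.mem_univ j)]
  intro k _ hk
  have : M i k = 0 := by_contra fun h0 => hk (h.unique h0 hij)
  rw [this, zero_mul]

/-- Steinberg's theorem for `[G(2,2,3)]₁ᵅ = W(D₃) ⋉ Λ` with lattice
`Λ = (ℤ + ℤα)(-e₁ - e₂) + (ℤ + ℤα)(e₁ - e₂) + (ℤ + ℤα)(e₂ - e₃)`, `α ∉ ℝ`. -/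
theorem steinberg_G_2_2_3_lattice1
    (α : ℂ) (hα : α.im ≠ 0)
    (Λ : Set (Fin 3 → ℂ))
    (hΛ : Λ = {v | ∃ a b c : ℂ, a ∈ Zlat α ∧ b ∈ Zlat α ∧ c ∈ Zlat α ∧
      v = a • ![-1, -1, 0] + b • ![1, -1, 0] + c • ![0, 1, -1]}) :
    SteinbergProperty (fun g => IsGrpn 2 2 3 g.1 ∧ g.2 ∈ Λ) := by
  subst hΛ
  rintro u ⟨⟨M, t⟩, ⟨⟨hrow, -, hroot, hprod⟩, ht⟩, ⟨v, hv⟩, hu⟩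
  dsimp only at hrow hroot hprod ht
  obtain ⟨ht, s, hs, hsum⟩ := mem_latticeD3_iff.1 ht
  have hsign (i j) (h : M i j ≠ 0) : M i j = 1 ∨ M i j = -1 := by
    simpa using hroot i j h
  have hfix (i j) (h : M i j ≠ 0) : u i - M i j * u j = t i := by
    have := congrFun hu i
    simp only [applyAff, Pi.add_apply, mulVec_apply_of_existsUnique (hrow i) h] at this
    linear_combination -this
  by_cases hoff : ∃ i j, i ≠ j ∧ M i j ≠ 0
  · obtain ⟨i, j, hij, h⟩ := hoff
    exact exists_reflectingHyperplane hij (hsign i j h) (hfix i j h ▸ ht i)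
  push Not at hoff
  have hdiag (i) : M i i ≠ 0 := by
    obtain ⟨j, hj, -⟩ := hrow i
    by_cases hij : i = j
    · exact hij ▸ hj
    · exact absurd (hoff i j hij) hj
  have hne : ¬ ∀ i, M i i = 1 := fun h => hv <| by
    have hM : M = 1 := by
      ext i j
      by_cases hij : i = j
      · subst hij
        simp [h]
      · simp [hij, hoff i j hij]
    subst hM
    have : t = 0 := by simpa [applyAff] using hu
    simp [applyAff, this]
  have hprod' : M 0 0 * M 1 1 * M 2 2 = 1 := by
    simpa [Fin.prod_univ_three, Fin.sum_univ_three, hoff] using hprod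
  have f0 := hfix 0 0 (hdiag 0)
  have f1 := hfix 1 1 (hdiag 1)
  have f2 := hfix 2 2 (hdiag 2)
  have hpair {i j : Fin 3} (hij : i ≠ j) (h : u i + u j = s) :
      ∃ H, IsReflectingHyperplane (fun g => IsGrpn 2 2 3 g.1 ∧ g.2 ∈ latticeD3 α) H ∧ u ∈ H :=
    exists_reflectingHyperplane hij (.inr rfl) (by rwa [neg_one_mul, sub_neg_eq_add, h])
  rcases hsign 0 0 (hdiag 0) with h0 | h0 <;> rcases hsign 1 1 (hdiag 1) with h1 | h1 <;>
    rcases hsign 2 2 (hdiag 2) with h2 | h2 <;> rw [h0, h1, h2] at hprod' <;>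
    rw [h0] at f0 <;> rw [h1] at f1 <;> rw [h2] at f2 <;> norm_num at hprod'
  · exact absurd (fun i => by fin_cases i <;> assumption) hne
  · exact hpair (i := 1) (j := 2) (by decide)
      (by linear_combination (f0 + f1 + f2 + hsum) / 2)
  · exact hpair (i := 0) (j := 2) (by decide)
      (by linear_combination (f0 + f1 + f2 + hsum) / 2)
  · exact hpair (i := 0) (j := 1) (by decide)
      (by linear_combination (f0 + f1 + f2 + hsum) / 2)
end
end

section
/- Let n ≥ 4, let α ∈ ℂ \ ℝ, and let Λ = (ℤ + ℤα)(−e_1 − e_2) + Σ_{j=2}^{n} (ℤ + ℤα)(e_{j-1} − e_j) ⊆ ℂⁿ (a G(2,2,n)-invariant ℤ-lattice of full rank 2n). Then the affine reflection group W = G(2,2,n) ⋉ Λ does NOT have the Steinberg property: there exist a non-identity element g ∈ W and a point u ∈ ℂⁿ with g(u) = u such that u lies on no reflecting hyperplane of W. (For example, g(v) = −v + (e_1 + (1+α)e_2 − αe_3) extended by the identity on the remaining coordinates is such an element when n = 4.) -/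
open Matrix Complex

noncomputable section

/-- `ℤ + ℤζ` as an additive subgroup of `ℂ`. -/
def zlatSubgroup (ζ : ℂ) : AddSubgroup ℂ where
  carrier := Zlat ζ
  zero_mem' := ⟨0, 0, by simp⟩
  add_mem' := by
    rintro _ _ ⟨a, b, rfl⟩ ⟨a', b', rfl⟩
    exact ⟨a + a', b + b', by push_cast; ring⟩
  neg_mem' := by
    rintro _ ⟨a, b, rfl⟩
    exact ⟨-a, -b, by push_cast; ring⟩

/-- If `α` is not real, then `(a + bα + m√2) / 2` lies in `ℤ + ℤα` only if `m = 0` and `a`, `b`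
are even. -/
lemma even_of_half_mem_Zlat {α : ℂ} (hα : α.im ≠ 0) {a b m : ℤ}
    (h : ((a : ℂ) + b * α + m * (√2 : ℝ)) / 2 ∈ Zlat α) : m = 0 ∧ 2 ∣ a ∧ 2 ∣ b := by
  obtain ⟨p, q, h⟩ := h
  have h' : (a : ℂ) + b * α + m * (√2 : ℝ) = 2 * p + 2 * q * α := by
    linear_combination 2 * h
  have him := congrArg Complex.im h'
  have hre := congrArg Complex.re h'
  simp at him hre
  have hb : b = 2 * q := by
    have : (b : ℝ) = 2 * q := him.resolve_right hα
    exact_mod_cast this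
  have hr : (a : ℝ) + m * √2 = 2 * p := by
    rw [hb] at hre
    push_cast at hre
    linarith
  have hm : m = 0 := by
    by_contra hm
    refine irrational_sqrt_two ⟨(2 * p - a) / m, ?_⟩
    have : (m : ℝ) ≠ 0 := by exact_mod_cast hm
    push_cast
    field_simp
    linarith
  refine ⟨hm, ⟨p, ?_⟩, ⟨q, hb⟩⟩
  rw [hm] at hr
  simp at hr
  exact_mod_cast hr

/-- A matrix all of whose off-diagonal entries vanish and which fixes a linear hyperplane pointwise
has at most one diagonal entry different from `1`. -/
lemma eq_of_diag_ne_one {n : ℕ} {M : Matrix (Fin n) (Fin n) ℂ} {a : Fin n → ℂ} (ha : a ≠ 0)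
    (hM : ∀ i j, i ≠ j → M i j = 0) (hfix : ∀ w, ∑ i, a i * w i = 0 → M *ᵥ w = w)
    {i j : Fin n} (hi : M i i ≠ 1) (hj : M j j ≠ 1) : i = j := by
  have key : ∀ {l}, M l l ≠ 1 → ∀ k, k ≠ l → a k = 0 := by
    intro l hl k hk
    have h := congrFun (hfix (Pi.single l (a k) - Pi.single k (a l)) (by
      simp [mul_sub, Finset.sum_sub_distrib, Pi.single_apply, mul_comm])) l
    have h' : a k * M l l = a k := by
      simpa [Matrix.mulVec_sub, Matrix.mulVec_single, hM l k hk.symm, hk.symm] using h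
    by_contra hak
    exact hl (mul_left_cancel₀ hak (by rw [h', mul_one]))
  by_contra hij
  refine ha (funext fun k => ?_)
  by_cases hk : k = i
  · exact key hj k (hk ▸ hij)
  · exact key hi k hk

/-- A point `u` no two of whose coordinates are congruent up to sign modulo `ℤ + ℤα` lies on no
reflecting hyperplane of `G(2,2,n) ⋉ Λ` when `Λ ⊆ (ℤ + ℤα)ⁿ`. -/
lemma notMem_of_isReflectingHyperplane {n : ℕ} {α : ℂ} {Λ : Set (Fin n → ℂ)}
    (hΛ : ∀ t ∈ Λ, ∀ i, t i ∈ Zlat α) {u : Fin n → ℂ}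
    (hadd : ∀ i j, i ≠ j → u i + u j ∉ Zlat α) (hsub : ∀ i j, i ≠ j → u i - u j ∉ Zlat α)
    {H : Set (Fin n → ℂ)}
    (hH : IsReflectingHyperplane (fun h => IsGrpn 2 2 n h.1 ∧ h.2 ∈ Λ) H) : u ∉ H := by
  obtain ⟨⟨a, ha, c, rfl⟩, ⟨M, t⟩, ⟨⟨hrow, -, hroot, hprod⟩, ht⟩, ⟨v, hv⟩, hfix⟩ := hH
  intro hu
  simp only [applyAff] at *
  have hfu := hfix u hu
  have hdiag : ∀ i j, i ≠ j → M i j = 0 := by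
    intro i j hij
    by_contra hne
    have hz : ∀ k, k ≠ j → M i k = 0 := fun k hk => by
      by_contra h
      exact hk ((hrow i).unique h hne)
    have hi : M i j * u j + t i = u i := by
      have := congrFun hfu i
      rwa [Pi.add_apply, Matrix.mulVec, dotProduct, Finset.sum_eq_single j
        (fun k _ hk => by rw [hz k hk, zero_mul]) (by simp)] at this
    rcases sq_eq_one_iff.mp (hroot i j hne) with h | h
    · refine hsub i j hij ?_
      rw [← hi, h, one_mul, add_sub_cancel_left]
      exact hΛ t ht i
    · refine hadd i j hij ?_
      rw [← hi, h]
      simpa using hΛ t ht i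
  have hlin : ∀ w, ∑ i, a i * w i = 0 → M *ᵥ w = w := by
    intro w hw
    have h := hfix (u + w) (by
      simpa [mul_add, Finset.sum_add_distrib, hw] using hu)
    rw [Matrix.mulVec_add] at h
    linear_combination h - hfu
  have hsum : ∀ i, ∑ j, M i j = M i i := fun i =>
    Finset.sum_eq_single i (fun j _ hj => hdiag i j hj.symm) (by simp)
  obtain ⟨i, hi⟩ : ∃ i, M i i ≠ 1 := by
    by_contra! h1
    have hM : M = 1 := by
      ext i j
      by_cases hij : i = j
      · subst hij
        simp [h1]
      · simp [hdiag i j hij, hij]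
    subst hM
    rw [Matrix.one_mulVec, add_eq_left] at hfu
    simp [hfu] at hv
  refine hi ?_
  rw [← hprod]
  simp only [hsum]
  rw [Finset.prod_eq_single i]
  · simp
  · intro j _ hj
    by_contra h
    exact hj (eq_of_diag_ne_one ha hdiag hlin h hi)
  · simp

/-- The groups `[G(2,2,n)]₁ᵅ`, `n ≥ 4`, with lattice
`Λ = (ℤ + ℤα)(-e₁ - e₂) + Σ_{j=2}^n (ℤ + ℤα)(e_{j-1} - e_j)`, `α ∉ ℝ`,
fail the Steinberg property. -/
theorem not_steinberg_G_2_2_n_lattice1 (n : ℕ) (hn : 4 ≤ n)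
    (α : ℂ) (hα : α.im ≠ 0)
    (Λ : Set (Fin n → ℂ))
    (hΛ : Λ = {v | ∃ c : Fin n → ℂ, (∀ j, c j ∈ Zlat α) ∧
      v = ∑ j, c j • (if (j : ℕ) = 0 then
        (fun i : Fin n => if (i : ℕ) = 0 then (-1 : ℂ) else if (i : ℕ) = 1 then -1 else 0)
        else stdGen n j)}) :
    ∃ g, (IsGrpn 2 2 n g.1 ∧ g.2 ∈ Λ) ∧ (∃ v, applyAff g v ≠ v) ∧
      ∃ u : Fin n → ℂ, applyAff g u = u ∧
        ∀ H, IsReflectingHyperplane (fun h => IsGrpn 2 2 n h.1 ∧ h.2 ∈ Λ) H → u ∉ H := by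
  have hentries : ∀ t ∈ Λ, ∀ i, t i ∈ Zlat α := by
    rw [hΛ]
    rintro _ ⟨c, hc, rfl⟩ i
    rw [Finset.sum_apply]
    change _ ∈ zlatSubgroup α
    refine sum_mem fun j _ => ?_
    have hj : c j ∈ zlatSubgroup α := hc j
    rw [Pi.smul_apply]
    split_ifs with h0 <;> simp only [stdGen, h0] <;> split_ifs <;> simp [hj, zero_mem]
  let a : Fin n → ℤ := fun k => if (k : ℕ) ≤ 1 then 1 else 0
  let b : Fin n → ℤ := fun k => if (k : ℕ) = 1 then 1 else if (k : ℕ) = 2 then -1 else 0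
  let m : Fin n → ℤ := fun k => if (k : ℕ) < 4 then 0 else k
  let u : Fin n → ℂ := fun k => ((a k : ℂ) + b k * α + m k * (√2 : ℝ)) / 2
  let d : Fin n → ℂ := fun k => if (k : ℕ) < 4 then -1 else 1
  let t : Fin n → ℂ := fun k => a k + b k * α
  have hd : ∀ k, d k ≠ 0 := fun k => by
    simp only [d]
    split_ifs <;> simp
  refine ⟨(Matrix.diagonal d, t), ⟨⟨?_, ?_, ?_, ?_⟩, ?_⟩, ?_, u, ?_, fun H hH =>
    notMem_of_isReflectingHyperplane hentries (fun i j hij h => ?_) (fun i j hij h => ?_) hH⟩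
  · exact fun i => ⟨i, by simp [hd], fun j hj => by
      by_contra h
      exact hj (Matrix.diagonal_apply_ne' d h)⟩
  · exact fun i => ⟨i, by simp [hd], fun j hj => by
      by_contra h
      exact hj (Matrix.diagonal_apply_ne d h)⟩
  · intro i j hij
    by_cases h : i = j
    · subst h
      simp only [Matrix.diagonal_apply_eq, d]
      split_ifs <;> simp
    · exact absurd (Matrix.diagonal_apply_ne d h) hij
  · obtain ⟨l, rfl⟩ := Nat.exists_eq_add_of_le hn
    simp [Matrix.diagonal_apply, d, Fin.prod_univ_add, Even.neg_one_pow (show Even 4 by decide)]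
  · rw [hΛ]
    refine ⟨fun j => if (j : ℕ) = 0 then -1 else if (j : ℕ) = 2 then α else 0, fun j => ?_, ?_⟩
    · dsimp only
      split_ifs
      exacts [⟨-1, 0, by simp⟩, ⟨0, 1, by simp⟩, ⟨0, 0, by simp⟩]
    · ext k
      rw [Finset.sum_apply, Finset.sum_eq_add (⟨0, by omega⟩ : Fin n) ⟨2, by omega⟩ (by simp)
        (fun j _ hj => by simp_all [Fin.ext_iff]) (by simp) (by simp)]
      have hk : (k : ℕ) = 0 ∨ (k : ℕ) = 1 ∨ (k : ℕ) = 2 ∨ 3 ≤ (k : ℕ) := by omega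
      rcases hk with hk | hk | hk | hk
      · simp [stdGen, t, a, b, Fin.ext_iff, hk]
      · simp [stdGen, t, a, b, Fin.ext_iff, hk]
      · simp [stdGen, t, a, b, Fin.ext_iff, hk]
      · have h0 : (k : ℕ) ≠ 0 := by omega
        have h1 : (k : ℕ) ≠ 1 := by omega
        have h2 : (k : ℕ) ≠ 2 := by omega
        have h3 : ¬ (k : ℕ) ≤ 1 := by omega
        simp [stdGen, t, a, b, Fin.ext_iff, h0, h1, h2, h3]
  · refine ⟨0, fun h => ?_⟩
    simpa [applyAff, t, a, b] using congrFun h ⟨0, by omega⟩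
  · ext k
    simp only [applyAff, Pi.add_apply, Matrix.mulVec_diagonal, d, t, u, a, b, m]
    by_cases hk : (k : ℕ) < 4
    · simp [hk]
      ring
    · have h1 : ¬ (k : ℕ) ≤ 1 := by omega
      have h2 : (k : ℕ) ≠ 1 := by omega
      have h3 : (k : ℕ) ≠ 2 := by omega
      simp [hk, h1, h2, h3]
  · have h' : ((a i + a j : ℤ) + (b i + b j : ℤ) * α + (m i + m j : ℤ) * (√2 : ℝ)) / 2
        ∈ Zlat α := by
      convert h using 1
      simp only [u]
      push_cast
      ring
    have := even_of_half_mem_Zlat hα h'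
    have := Fin.val_ne_of_ne hij
    simp only [a, b, m] at *
    omega
  · have h' : ((a i - a j : ℤ) + (b i - b j : ℤ) * α + (m i - m j : ℤ) * (√2 : ℝ)) / 2
        ∈ Zlat α := by
      convert h using 1
      simp only [u]
      push_cast
      ring
    have := even_of_half_mem_Zlat hα h'
    have := Fin.val_ne_of_ne hij
    simp only [a, b, m] at *
    omega
end
end

section
/- Let r, p, n be positive integers with p dividing r, r ≠ p, and n ≥ 1, let Λ ⊆ ℂⁿ be a G(r,p,n)-invariant ℤ-lattice, and let W = G(r,p,n) ⋉ Λ. Let g ∈ W and write λ_1,…,λ_n for the diagonal entries of the monomial matrix Lin(g). Suppose that for some index j: λ_j ∉ {0,1}, λ_j^p ≠ 1 (so in particular g^p ≠ 1), and x_j(Tran(g^p))·e_1 ∈ Λ. Then every vector of ℂⁿ fixed by g lies on a reflecting hyperplane of W. -/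
open Matrix Complex

noncomputable section

theorem isGrpn_diagonal_update {r p n : ℕ} (hr : 0 < r) (j : Fin n) {z : ℂ}
    (hzr : z ^ r = 1) (hz : z ^ (r / p) = 1) :
    IsGrpn r p n (diagonal (Function.update (1 : Fin n → ℂ) j z)) := by
  have hz0 : z ≠ 0 := by
    rintro rfl
    simp [hr.ne'] at hzr
  have hd : ∀ i, (Function.update (1 : Fin n → ℂ) j z) i ≠ 0 := by
    intro i
    by_cases h : i = j
    · subst h; simpa using hz0
    · simp [h]
  refine ⟨fun i => ⟨i, by simpa using hd i, fun k hk => ?_⟩,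
    fun i => ⟨i, by simpa using hd i, fun k hk => ?_⟩, fun i k hk => ?_, ?_⟩
  · by_contra h
    exact hk (diagonal_apply_ne _ (Ne.symm h))
  · by_contra h
    exact hk (diagonal_apply_ne _ h)
  · have h : i = k := by
      by_contra h
      exact hk (diagonal_apply_ne _ h)
    subst h
    by_cases hi : i = j
    · subst hi; simpa using hzr
    · simp [hi]
  · have hs : ∀ i, ∑ k, diagonal (Function.update (1 : Fin n → ℂ) j z) i k =
        Function.update (1 : Fin n → ℂ) j z i := by
      intro i
      simp [diagonal_apply]
    simp only [hs]
    rw [Finset.prod_update_of_mem (Finset.mem_univ j)]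
    simpa using hz

theorem isGrpn_permMatrix (r p : ℕ) {n : ℕ} (σ : Equiv.Perm (Fin n)) :
    IsGrpn r p n (σ.permMatrix ℂ) := by
  refine ⟨fun i => ⟨σ i, by simp, fun k hk => ?_⟩,
    fun k => ⟨σ.symm k, by simp, fun i hi => ?_⟩, fun i k hk => ?_, ?_⟩
  · by_contra h
    exact hk (by simp [Ne.symm h])
  · rw [Equiv.eq_symm_apply]
    by_contra h
    exact hi (by simp [h])
  · have hM : σ.permMatrix ℂ i k = if σ i = k then 1 else 0 := by
      simp [Equiv.Perm.permMatrix, PEquiv.toMatrix_apply, eq_comm]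
    rw [hM] at hk ⊢
    split_ifs at hk ⊢ <;> simp_all
  · simp

theorem applyAff_apply_of_row {n : ℕ} {g : Matrix (Fin n) (Fin n) ℂ × (Fin n → ℂ)}
    {j : Fin n} (hrow : ∀ k, k ≠ j → g.1 j k = 0) (v : Fin n → ℂ) :
    applyAff g v j = g.1 j j * v j + g.2 j := by
  simp only [applyAff, Pi.add_apply, mulVec, dotProduct]
  rw [Finset.sum_eq_single j (fun k _ hk => by simp [hrow k hk]) (by simp)]

theorem iterate_applyAff_sub_apply {n : ℕ} {g : Matrix (Fin n) (Fin n) ℂ × (Fin n → ℂ)}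
    {j : Fin n} (hrow : ∀ k, k ≠ j → g.1 j k = 0) (u v : Fin n → ℂ) (m : ℕ) :
    (applyAff g)^[m] u j - (applyAff g)^[m] v j = g.1 j j ^ m * (u j - v j) := by
  induction m with
  | zero => simp
  | succ m ih =>
    rw [Function.iterate_succ_apply', Function.iterate_succ_apply',
      applyAff_apply_of_row hrow, applyAff_apply_of_row hrow, pow_succ']
    linear_combination g.1 j j * ih

/-- Lemma 5.1(1): if `λ_j ∉ {0,1}`, `λ_j^p ≠ 1`, and `x_j(Tran(gᵖ))·e₁ ∈ Λ`, then
every vector fixed by `g ∈ W = G(r,p,n) ⋉ Λ` lies on a reflecting hyperplane of `W`. -/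
theorem fixed_lies_on_reflecting_hyperplane_case1
    (r p n : ℕ) (hr : 0 < r) (hp : 0 < p) (hpr : p ∣ r) (hrp : r ≠ p) (hn : 1 ≤ n)
    (Λ : Set (Fin n → ℂ))
    (hlat : ∃ (k : ℕ) (b : Fin k → (Fin n → ℂ)), LinearIndependent ℝ b ∧
      Λ = {v | ∃ c : Fin k → ℤ, v = ∑ i, (c i : ℂ) • b i})
    (hinv : ∀ M, IsGrpn r p n M → ∀ v ∈ Λ, M.mulVec v ∈ Λ)
    (g : Matrix (Fin n) (Fin n) ℂ × (Fin n → ℂ))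
    (hgW : IsGrpn r p n g.1 ∧ g.2 ∈ Λ)
    (j : Fin n) (hj0 : g.1 j j ≠ 0) (hj1 : g.1 j j ≠ 1) (hjp : g.1 j j ^ p ≠ 1)
    (htr : ((applyAff g)^[p] 0 j) •
      (Pi.single (⟨0, by omega⟩ : Fin n) (1 : ℂ) : Fin n → ℂ) ∈ Λ) :
    ∀ u : Fin n → ℂ, applyAff g u = u →
      ∃ H, IsReflectingHyperplane (fun h => IsGrpn r p n h.1 ∧ h.2 ∈ Λ) H ∧ u ∈ H := by
  intro u hu
  obtain ⟨⟨hrows, -, hroot, -⟩, -⟩ := hgW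
  have hrow : ∀ k, k ≠ j → g.1 j k = 0 := fun k hk => by
    by_contra h
    exact hk ((hrows j).unique h hj0)
  have hr1 : g.1 j j ^ r = 1 := hroot j j hj0
  set t : ℂ := (applyAff g)^[p] 0 j with ht
  have hfix : g.1 j j ^ p * u j + t = u j := by
    have h := iterate_applyAff_sub_apply hrow u 0 p
    rw [Function.iterate_fixed hu, ← ht, Pi.zero_apply] at h
    linear_combination -h
  have htΛ : (Pi.single j t : Fin n → ℂ) ∈ Λ := by
    have h := hinv _ (isGrpn_permMatrix r p (Equiv.swap ⟨0, by omega⟩ j)) _ htr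
    rw [permMatrix_mulVec] at h
    convert h using 1
    ext i
    simp [Pi.single_apply, Equiv.swap_apply_eq_iff]
  have hA : ∀ v i, applyAff (diagonal (Function.update 1 j (g.1 j j ^ p)), Pi.single j t) v i =
      if i = j then g.1 j j ^ p * v j + t else v i := by
    intro v i
    by_cases hi : i = j
    · subst hi; simp [applyAff, mulVec_diagonal]
    · simp [applyAff, mulVec_diagonal, hi]
  refine ⟨{v | v j = u j}, ⟨⟨Pi.single j 1, by simp, u j, by simp [Pi.single_apply]⟩,
    (diagonal (Function.update 1 j (g.1 j j ^ p)), Pi.single j t),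
    ⟨isGrpn_diagonal_update hr j ?_ ?_, htΛ⟩, ⟨u + Pi.single j 1, fun h => hjp ?_⟩,
    fun v hv => ?_⟩, rfl⟩
  · rw [← pow_mul, mul_comm, pow_mul, hr1, one_pow]
  · rw [← pow_mul, Nat.mul_div_cancel' hpr, hr1]
  · have h := congrFun h j
    simp only [hA, if_true, Pi.add_apply, Pi.single_eq_same] at h
    linear_combination h - hfix
  · have hv : v j = u j := hv
    ext i
    rw [hA]
    split_ifs with hi
    · rw [hi, hv, hfix]
    · rfl
end
end

section
/- Let r, p, n be positive integers with p dividing r, r ≠ p, and n ≥ 1, let Λ ⊆ ℂⁿ be a G(r,p,n)-invariant ℤ-lattice, and let W = G(r,p,n) ⋉ Λ. Let g ∈ W with g^p = 1 and write λ_1,…,λ_n for the diagonal entries of the monomial matrix Lin(g). Suppose that for some index j: λ_j ∉ {0,1} and x_j(Tran(g))·e_1 ∈ (1 − λ_j)·Λ. Then every vector of ℂⁿ fixed by g lies on a reflecting hyperplane of W. -/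
open Matrix Complex

noncomputable section

/-- The monomial matrix whose entry at `(a, σ a)` is `c a`. -/
def monomialMatrix {n : ℕ} (σ : Equiv.Perm (Fin n)) (c : Fin n → ℂ) :
    Matrix (Fin n) (Fin n) ℂ :=
  fun a b => if σ a = b then c a else 0

theorem monomialMatrix_mulVec {n : ℕ} (σ : Equiv.Perm (Fin n)) (c v : Fin n → ℂ) (a : Fin n) :
    (monomialMatrix σ c).mulVec v a = c a * v (σ a) := by
  simp [monomialMatrix, Matrix.mulVec, dotProduct]

theorem isGrpn_monomialMatrix {r p n : ℕ} (hr : 0 < r) (σ : Equiv.Perm (Fin n)) (c : Fin n → ℂ)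
    (hc : ∀ a, c a ^ r = 1) (hprod : (∏ a, c a) ^ (r / p) = 1) :
    IsGrpn r p n (monomialMatrix σ c) := by
  have hc0 : ∀ a, c a ≠ 0 := fun a h => by
    simpa [h, hr.ne'] using hc a
  refine ⟨fun a => ⟨σ a, by simpa [monomialMatrix] using hc0 a, fun b hb => ?_⟩,
    fun b => ⟨σ.symm b, by simpa [monomialMatrix] using hc0 _, fun a ha => ?_⟩,
    fun a b hab => ?_, by simpa [monomialMatrix] using hprod⟩
  · by_contra h
    exact hb (if_neg fun h' => h h'.symm)
  · by_contra h
    exact ha (if_neg fun h' => h (by simp [← h']))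
  · have h : σ a = b := by
      by_contra h
      exact hab (if_neg h)
    simpa [monomialMatrix, h] using hc a

theorem IsGrpn.mulVec_apply_of_diag_ne_zero {r p n : ℕ} {M : Matrix (Fin n) (Fin n) ℂ}
    (hM : IsGrpn r p n M) {j : Fin n} (hj : M j j ≠ 0) (v : Fin n → ℂ) :
    M.mulVec v j = M j j * v j := by
  rw [Matrix.mulVec, dotProduct, Finset.sum_eq_single j _ (by simp)]
  intro b _ hb
  by_contra h
  exact hb ((hM.1 j).unique (left_ne_zero_of_mul h) hj)

theorem sub_mem_of_eq_integer_span {n k : ℕ} {Λ : Set (Fin n → ℂ)} {b : Fin k → (Fin n → ℂ)}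
    (hΛ : Λ = {v | ∃ c : Fin k → ℤ, v = ∑ i, (c i : ℂ) • b i}) {v w : Fin n → ℂ}
    (hv : v ∈ Λ) (hw : w ∈ Λ) : v - w ∈ Λ := by
  subst hΛ
  obtain ⟨c, rfl⟩ := hv
  obtain ⟨d, rfl⟩ := hw
  exact ⟨c - d, by simp [sub_smul, Finset.sum_sub_distrib]⟩

/-- Lemma 5.1(2): if `gᵖ = 1`, `λ_j ∉ {0,1}`, and `x_j(Tran(g))·e₁ ∈ (1 - λ_j)Λ`, then
every vector fixed by `g ∈ W = G(r,p,n) ⋉ Λ` lies on a reflecting hyperplane of `W`. -/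
theorem fixed_lies_on_reflecting_hyperplane_case2
    (r p n : ℕ) (hr : 0 < r) (hp : 0 < p) (hpr : p ∣ r) (hrp : r ≠ p) (hn : 1 ≤ n)
    (Λ : Set (Fin n → ℂ))
    (hlat : ∃ (k : ℕ) (b : Fin k → (Fin n → ℂ)), LinearIndependent ℝ b ∧
      Λ = {v | ∃ c : Fin k → ℤ, v = ∑ i, (c i : ℂ) • b i})
    (hinv : ∀ M, IsGrpn r p n M → ∀ v ∈ Λ, M.mulVec v ∈ Λ)
    (g : Matrix (Fin n) (Fin n) ℂ × (Fin n → ℂ))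
    (hgW : IsGrpn r p n g.1 ∧ g.2 ∈ Λ)
    (hgp : (applyAff g)^[p] = id)
    (j : Fin n) (hj0 : g.1 j j ≠ 0) (hj1 : g.1 j j ≠ 1)
    (htr : ∃ μ ∈ Λ, (g.2 j) •
      (Pi.single (⟨0, by omega⟩ : Fin n) (1 : ℂ) : Fin n → ℂ) = (1 - g.1 j j) • μ) :
    ∀ u : Fin n → ℂ, applyAff g u = u →
      ∃ H, IsReflectingHyperplane (fun h => IsGrpn r p n h.1 ∧ h.2 ∈ Λ) H ∧ u ∈ H := by
  intro u hu
  obtain ⟨k, b, -, hΛ⟩ := hlat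
  obtain ⟨μ, hμ, hμe⟩ := htr
  have h1 : (1 - g.1 j j) ≠ 0 := sub_ne_zero.2 hj1.symm
  have huj : g.2 j = (1 - g.1 j j) * u j := by
    have h := congrFun hu j
    simp only [applyAff, Pi.add_apply, hgW.1.mulVec_apply_of_diag_ne_zero hj0] at h
    linear_combination h
  have hμ1 : μ = Pi.single (⟨0, by omega⟩ : Fin n) (u j) := by
    apply smul_right_injective _ h1
    simp only
    rw [← hμe, huj]
    ext a
    simp [Pi.single_apply]
  have hej : (Pi.single j (u j) : Fin n → ℂ) ∈ Λ := by
    have h := hinv (monomialMatrix (Equiv.swap (⟨0, by omega⟩ : Fin n) j) 1)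
      (isGrpn_monomialMatrix hr _ _ (by simp) (by simp)) μ hμ
    convert h using 1
    ext a
    rw [monomialMatrix_mulVec, hμ1]
    simp only [Pi.single_apply, Pi.one_apply, one_mul, Equiv.swap_apply_eq_iff,
      Equiv.swap_apply_left]
  obtain ⟨q, rfl⟩ := hpr
  have hq : p * q / p = q := Nat.mul_div_cancel_left q hp
  have hq0 : q ≠ 0 := by rintro rfl; simp at hr
  have hq1 : q ≠ 1 := by rintro rfl; simp at hrp
  have hξ := Complex.isPrimitiveRoot_exp q hq0
  set ξ := Complex.exp (2 * Real.pi * Complex.I / q)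
  have hξ1 : ξ ≠ 1 := hξ.ne_one (by omega)
  have hs : IsGrpn (p * q) p n (monomialMatrix (Equiv.refl _) (Pi.mulSingle j ξ)) := by
    refine isGrpn_monomialMatrix hr _ _ (fun a => ?_) ?_
    · by_cases h : a = j
      · subst h
        simp [mul_comm p q, pow_mul, hξ.pow_eq_one]
      · simp [h]
    · rw [Finset.prod_eq_single j (by intro a _ h; simp [h]) (by simp), hq]
      simpa using hξ.pow_eq_one
  refine ⟨{v | ∑ i, (Pi.single j 1 : Fin n → ℂ) i * v i = u j},
    ⟨⟨Pi.single j 1, by simp, u j, rfl⟩,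
      (monomialMatrix (Equiv.refl _) (Pi.mulSingle j ξ), Pi.single j ((1 - ξ) * u j)),
      ⟨hs, ?_⟩, ⟨Pi.single j (u j + 1), fun h => hξ1 ?_⟩, fun v hv => ?_⟩, ?_⟩
  · convert sub_mem_of_eq_integer_span hΛ hej (hinv _ hs _ hej) using 1
    ext a
    rw [Pi.sub_apply, monomialMatrix_mulVec]
    by_cases h : a = j
    · subst h
      simp [sub_mul]
    · simp [h]
  · have h' := congrFun h j
    simp only [applyAff, Pi.add_apply, monomialMatrix_mulVec, Pi.mulSingle_eq_same,
      Equiv.refl_apply, Pi.single_eq_same] at h'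
    linear_combination h'
  · have hv' : v j = u j := by simpa [Pi.single_apply] using hv
    ext a
    rw [applyAff, Pi.add_apply, monomialMatrix_mulVec]
    by_cases h : a = j
    · subst h
      simp only [Pi.mulSingle_eq_same, Equiv.refl_apply, Pi.single_eq_same, hv']
      ring
    · simp [h]
  · simp [Pi.single_apply]
end
end
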